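/- Assume the factorization theorem for stabilizer states: every stabilizer state on (C^D)^{⊗n}, where D = ∏_{i=1}^m q_i with q_i = p_i^{e_i} distinct prime powers, is local-unitarily equivalent (by U^{⊗n} for a single unitary U: C^D → ⊗_i C^{q_i}) to a tensor product ⊗_i |φ_i⟩ of stabilizer states |φ_i⟩ ∈ (C^{q_i})^{⊗n}. Then: if a stabilizer AME(n, D) state exists, for every nonempty subset M ⊆ {1,…,m} there exists a stabilizer AME(n, ∏_{i∈M} q_i) state. -/

import Mathlib

noncomputable section

open Matrix Complex BigOperators

/-- `ω = e^{2πi/D}`. -/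
def omegaD (D : ℕ) : ℂ := Complex.exp (2 * Real.pi * Complex.I / D)

/-- The clock operator `Z = ∑_j ω^j |j⟩⟨j|` on `ℂ^D`. -/
def Zc (D : ℕ) : Matrix (Fin D) (Fin D) ℂ :=
  Matrix.diagonal fun j => omegaD D ^ (j : ℕ)

/-- The shift operator `X = ∑_j |j⟩⟨j+1|` on `ℂ^D` (indices mod `D`). -/
def Xc (D : ℕ) : Matrix (Fin D) (Fin D) ℂ :=
  Matrix.of fun j k => if (k : ℕ) = ((j : ℕ) + 1) % D then 1 else 0

/-- Combine an assignment on `S` and on its complement into one on `Fin n`. -/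
def glue {n : ℕ} {τ : Type*} (S : Finset (Fin n)) (a : {i // i ∈ S} → τ)
    (f : {i // i ∉ S} → τ) : Fin n → τ :=
  fun i => if h : i ∈ S then a ⟨i, h⟩ else f ⟨i, h⟩

/-- The reduced density matrix of a pure state `ψ ∈ (ℂ^τ)^{⊗n}` on the parties in `S`
(tracing out the complement of `S`). -/
def rdm {n : ℕ} {τ : Type*} [Fintype τ] (S : Finset (Fin n))
    (ψ : (Fin n → τ) → ℂ) :
    Matrix ({i // i ∈ S} → τ) ({i // i ∈ S} → τ) ℂ :=
  Matrix.of fun a b =>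
    ∑ f : {i // i ∉ S} → τ, ψ (glue S a f) * (starRingEnd ℂ) (ψ (glue S b f))

/-- `ψ` is an absolutely maximally entangled state: it is a unit vector and every reduction
to `⌊n/2⌋` parties is maximally mixed. -/
def IsAME {n : ℕ} {τ : Type*} [Fintype τ] [DecidableEq τ] (ψ : (Fin n → τ) → ℂ) : Prop :=
  (∑ g, Complex.normSq (ψ g) = 1) ∧
  ∀ S : Finset (Fin n), S.card = n / 2 →
    rdm S ψ = ((Fintype.card τ : ℂ) ^ S.card)⁻¹ • (1 : Matrix _ _ ℂ)

/-- An `n`-qudit Pauli product `λ^γ X^{x_1}Z^{z_1} ⊗ ⋯ ⊗ X^{x_n}Z^{z_n}` with `λ = e^{πi/D}`. -/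
def pauliProd (n D : ℕ) (γ : ℕ) (x z : Fin n → ℕ) :
    Matrix (Fin n → Fin D) (Fin n → Fin D) ℂ :=
  Complex.exp (Real.pi * Complex.I / D) ^ γ •
    Matrix.of fun a b => ∏ k, (Xc D ^ (x k) * Zc D ^ (z k)) (a k) (b k)

/-- A matrix is a Pauli product. -/
def IsPauliProd {n D : ℕ} (M : Matrix (Fin n → Fin D) (Fin n → Fin D) ℂ) : Prop :=
  ∃ γ x z, M = pauliProd n D γ x z

/-- `ψ` is a stabilizer state: a unit vector fixed by an abelian group of `D^n` linearly
independent Pauli products. -/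
def IsStabState {n D : ℕ} (ψ : (Fin n → Fin D) → ℂ) : Prop :=
  (∑ g, Complex.normSq (ψ g) = 1) ∧
  ∃ S : Finset (Matrix (Fin n → Fin D) (Fin n → Fin D) ℂ),
    (∀ s ∈ S, IsPauliProd s) ∧ (1 : Matrix _ _ ℂ) ∈ S ∧
    (∀ s ∈ S, ∀ t ∈ S, s * t ∈ S ∧ s * t = t * s) ∧
    LinearIndependent ℂ (fun s : S => (s : Matrix (Fin n → Fin D) (Fin n → Fin D) ℂ)) ∧
    S.card = D ^ n ∧ (∀ s ∈ S, s.mulVec ψ = ψ)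

/-- The regrouped tensor product of states `ψ i ∈ (ℂ^{q i})^{⊗n}`, viewed as a state on
`(⊗_i ℂ^{q i})^{⊗n}`. -/
def regroup {n m : ℕ} (q : Fin m → ℕ) (ψ : ∀ i, (Fin n → Fin (q i)) → ℂ) :
    (Fin n → ∀ i, Fin (q i)) → ℂ :=
  fun g => ∏ i, ψ i fun k => g k i

/-- The `n`-fold tensor power `U^{⊗n}` of a matrix `U`. -/
def tpow {α β : Type*} (n : ℕ) (U : Matrix α β ℂ) : Matrix (Fin n → α) (Fin n → β) ℂ :=
  Matrix.of fun g f => ∏ k, U (g k) (f k)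

/-- The Kronecker product of a finite family of (rectangular) matrices. -/
def piKronecker {ι : Type*} [Fintype ι] {α β : ι → Type*}
    (A : ∀ i, Matrix (α i) (β i) ℂ) : Matrix (∀ i, α i) (∀ i, β i) ℂ :=
  Matrix.of fun a b => ∏ i, A i (a i) (b i)

section Kronecker

variable {ι : Type*} [Fintype ι] {α β γ : ι → Type*}

lemma piKronecker_mul [DecidableEq ι] [∀ i, Fintype (β i)] (A : ∀ i, Matrix (α i) (β i) ℂ)
    (B : ∀ i, Matrix (β i) (γ i) ℂ) :
    piKronecker A * piKronecker B = piKronecker fun i => A i * B i := by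
  ext a c
  simp only [piKronecker, Matrix.mul_apply, Matrix.of_apply, ← Finset.prod_mul_distrib]
  rw [Finset.prod_univ_sum, Fintype.piFinset_univ]

lemma piKronecker_one [∀ i, DecidableEq (α i)] :
    piKronecker (fun i => (1 : Matrix (α i) (α i) ℂ)) = 1 := by
  ext a b
  simp only [piKronecker, Matrix.of_apply, Matrix.one_apply]
  rw [Fintype.prod_ite_zero]
  simp [funext_iff]

lemma piKronecker_conjTranspose (A : ∀ i, Matrix (α i) (β i) ℂ) :
    (piKronecker A)ᴴ = piKronecker fun i => (A i)ᴴ := by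
  ext a b
  simp [piKronecker, Matrix.conjTranspose_apply]

lemma piKronecker_mulVec_prod [DecidableEq ι] [∀ i, Fintype (β i)] (A : ∀ i, Matrix (α i) (β i) ℂ)
    (v : ∀ i, β i → ℂ) (a : ∀ i, α i) :
    (piKronecker A).mulVec (fun b => ∏ i, v i (b i)) a = ∏ i, (A i).mulVec (v i) (a i) := by
  simp only [piKronecker, Matrix.mulVec, dotProduct, Matrix.of_apply,
    ← Finset.prod_mul_distrib]
  rw [Finset.prod_univ_sum, Fintype.piFinset_univ]

end Kronecker

lemma exists_mul_eq_one_of_linearIndependent_row {m n : Type*} [Fintype m] [DecidableEq m]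
    [Fintype n] [DecidableEq n] {V : Matrix m n ℂ} (h : LinearIndependent ℂ V.row) :
    ∃ W : Matrix n m ℂ, V * W = 1 := by
  obtain ⟨g, hg⟩ := V.vecMulLinear.exists_leftInverse_of_injective
    (LinearMap.ker_eq_bot.2 (Matrix.vecMul_injective_iff.2 h))
  refine ⟨(LinearMap.toMatrix' g)ᵀ, ?_⟩
  have h1 : ∀ c, c ᵥ* (V * (LinearMap.toMatrix' g)ᵀ) = c := fun c => by
    rw [← Matrix.vecMul_vecMul, Matrix.vecMul_transpose, ← Matrix.toLin'_apply,
      Matrix.toLin'_toMatrix']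
    exact LinearMap.congr_fun hg c
  ext i j
  simpa [Matrix.single_one_vecMul, Matrix.one_apply, Pi.single_apply, eq_comm] using
    congrFun (h1 (Pi.single i 1)) j

lemma linearIndependent_row_of_mul_eq_one {m n : Type*} [Fintype m] [DecidableEq m]
    [Fintype n] {V : Matrix m n ℂ} {W : Matrix n m ℂ} (h : V * W = 1) :
    LinearIndependent ℂ V.row := by
  rw [← Matrix.vecMul_injective_iff]
  intro c d hcd
  have := congrArg (fun u => u ᵥ* W) hcd
  simpa [Matrix.vecMul_vecMul, h] using this

/-- Kronecker products of linearly independent families of matrices are linearly independent. -/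
lemma linearIndependent_piKronecker {ι : Type*} [Fintype ι] [DecidableEq ι]
    {κ α : ι → Type*} [∀ i, Fintype (κ i)] [∀ i, DecidableEq (κ i)]
    [∀ i, Fintype (α i)] [∀ i, DecidableEq (α i)] {v : ∀ i, κ i → Matrix (α i) (α i) ℂ}
    (h : ∀ i, LinearIndependent ℂ (v i)) :
    LinearIndependent ℂ fun s : ∀ i, κ i => piKronecker fun i => v i (s i) := by
  have hV : ∀ i, LinearIndependent ℂ
      (Matrix.of fun (s : κ i) (p : α i × α i) => v i s p.1 p.2).row := fun i =>
    (h i).map' (LinearEquiv.curry ℂ ℂ (α i) (α i)).symm.toLinearMap (LinearEquiv.ker _)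
  choose W hW using fun i => exists_mul_eq_one_of_linearIndependent_row (hV i)
  have hVW := piKronecker_mul
    (fun i => Matrix.of fun (s : κ i) (p : α i × α i) => v i s p.1 p.2) W
  simp only [hW, piKronecker_one] at hVW
  have := linearIndependent_row_of_mul_eq_one hVW
  rw [Fintype.linearIndependent_iff] at this ⊢
  refine fun c hc => this c ?_
  ext p
  have := congrFun (congrFun hc fun i => (p i).1) fun i => (p i).2
  simpa [Matrix.sum_apply, piKronecker] using this

/-- The tensor power of a matrix, indexed by a finite type. -/
abbrev kroneckerPow (κ : Type*) [Fintype κ] {α β : Type*} (U : Matrix α β ℂ) :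
    Matrix (κ → α) (κ → β) ℂ :=
  piKronecker fun _ => U

section Reduction

variable {n : ℕ}

/-- Splitting an assignment into its parts on `S` and on the complement of `S`. -/
def glueEquiv (τ : Type*) (S : Finset (Fin n)) :
    (({i // i ∈ S} → τ) × ({i // i ∉ S} → τ)) ≃ (Fin n → τ) :=
  (Equiv.piEquivPiSubtypeProd (fun i => i ∈ S) fun _ => τ).symm

lemma glueEquiv_apply {τ : Type*} (S : Finset (Fin n)) (a : {i // i ∈ S} → τ)
    (f : {i // i ∉ S} → τ) : glueEquiv τ S (a, f) = glue S a f := rfl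

lemma prod_glue {τ : Type*} (S : Finset (Fin n)) (a : {i // i ∈ S} → τ)
    (f : {i // i ∉ S} → τ) (F : Fin n → τ → ℂ) :
    ∏ k, F k (glue S a f k) = (∏ k, F k.1 (a k)) * ∏ k, F k.1 (f k) := by
  rw [← Fintype.prod_subtype_mul_prod_subtype (fun k => k ∈ S)]
  have hS : ∀ k : {i // i ∈ S}, F k (glue S a f k) = F k (a k) := fun k => by
    simp [glue]
  have hS' : ∀ k : {i // i ∉ S}, F k (glue S a f k) = F k (f k) := fun k => by
    simp [glue, k.2]
  convert congrArg₂ (· * ·) (Fintype.prod_congr _ _ hS) (Fintype.prod_congr _ _ hS')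

variable {τ σ : Type*} [Fintype τ]

/-- The coefficient matrix of `ψ` across the bipartition given by `S`. -/
def coeffMatrix (S : Finset (Fin n)) (ψ : (Fin n → τ) → ℂ) :
    Matrix ({i // i ∈ S} → τ) ({i // i ∉ S} → τ) ℂ :=
  Matrix.of fun a f => ψ (glue S a f)

lemma rdm_eq_mul_conjTranspose (S : Finset (Fin n)) (ψ : (Fin n → τ) → ℂ) :
    rdm S ψ = coeffMatrix S ψ * (coeffMatrix S ψ)ᴴ := rfl

lemma coeffMatrix_tpow_mulVec (S : Finset (Fin n)) (U : Matrix σ τ ℂ)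
    (ψ : (Fin n → τ) → ℂ) :
    coeffMatrix S ((tpow n U).mulVec ψ) =
      kroneckerPow {i // i ∈ S} U * coeffMatrix S ψ * (kroneckerPow {i // i ∉ S} U)ᵀ := by
  ext a f
  simp only [coeffMatrix, tpow, piKronecker, Matrix.mulVec, dotProduct, Matrix.of_apply,
    Matrix.mul_apply, Matrix.transpose_apply, Finset.sum_mul]
  rw [← (glueEquiv τ S).sum_comp, Fintype.sum_prod_type_right]
  refine Finset.sum_congr rfl fun f' _ => Finset.sum_congr rfl fun a' _ => ?_
  have hU : ∀ k, U (glue S a f k) (glue S a' f' k) =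
      (fun x : σ × τ => U x.1 x.2) (glue S (fun k => (a k, a' k)) (fun k => (f k, f' k)) k) := by
    intro k
    by_cases hk : k ∈ S <;> simp [glue, hk]
  simp only [glueEquiv_apply, hU]
  rw [prod_glue S _ _ fun _ (x : σ × τ) => U x.1 x.2]
  ring

/-- Local unitaries preserve maximally mixed reductions. -/
lemma rdm_tpow_mulVec_of_unitary [Fintype σ] [DecidableEq τ] [DecidableEq σ] (S : Finset (Fin n))
    {U : Matrix σ τ ℂ} (hU : Uᴴ * U = 1) (hU' : U * Uᴴ = 1) (ψ : (Fin n → τ) → ℂ) (c : ℂ)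
    (h : rdm S ψ = c • (1 : Matrix _ _ ℂ)) :
    rdm S ((tpow n U).mulVec ψ) = c • (1 : Matrix _ _ ℂ) := by
  rw [rdm_eq_mul_conjTranspose] at h ⊢
  rw [coeffMatrix_tpow_mulVec]
  set P : Matrix ({i // i ∈ S} → σ) ({i // i ∈ S} → τ) ℂ := kroneckerPow _ U
  set Q : Matrix ({i // i ∉ S} → σ) ({i // i ∉ S} → τ) ℂ := kroneckerPow _ U
  have hP : P * Pᴴ = 1 := by
    simp only [P, piKronecker_conjTranspose, piKronecker_mul, hU', piKronecker_one]
  have hQ : Qᴴ * Q = 1 := by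
    simp only [Q, piKronecker_conjTranspose, piKronecker_mul, hU, piKronecker_one]
  have hQ' : Qᵀ * Qᵀᴴ = 1 := by
    have := congrArg Matrix.transpose hQ
    rwa [Matrix.transpose_mul, Matrix.transpose_one] at this
  calc P * coeffMatrix S ψ * Qᵀ * (P * coeffMatrix S ψ * Qᵀ)ᴴ
      = P * (coeffMatrix S ψ * (Qᵀ * Qᵀᴴ) * (coeffMatrix S ψ)ᴴ) * Pᴴ := by
        simp only [Matrix.conjTranspose_mul, Matrix.mul_assoc]
    _ = c • 1 := by rw [hQ', Matrix.mul_one, h]; simp [hP]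

lemma trace_rdm (S : Finset (Fin n)) (ψ : (Fin n → τ) → ℂ) :
    ∑ a, rdm S ψ a a = ((∑ g, Complex.normSq (ψ g) : ℝ) : ℂ) := by
  rw [← (glueEquiv τ S).sum_comp, Fintype.sum_prod_type]
  simp [rdm, Complex.mul_conj, glueEquiv_apply]

end Reduction

section Tensor

variable {n : ℕ} {ι : Type*} {τ : Type*} {σ : ι → Type*}

/-- Splitting assignments of `τ`-values along an identification `τ ≃ ∏ i, σ i`. -/
def splitEquiv (κ : Type*) (e : τ ≃ ∀ i, σ i) : (κ → τ) ≃ ∀ i, κ → σ i :=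
  (Equiv.piCongrRight fun _ => e).trans (Equiv.piComm _)

/-- The tensor product of states, regrouped along an identification `τ ≃ ∏ i, σ i`. -/
def tensorState [Fintype ι] (e : τ ≃ ∀ i, σ i) (φ : ∀ i, (Fin n → σ i) → ℂ) : (Fin n → τ) → ℂ :=
  fun g => ∏ i, φ i (splitEquiv _ e g i)

lemma splitEquiv_glue (e : τ ≃ ∀ i, σ i) (S : Finset (Fin n)) (a : {i // i ∈ S} → τ)
    (f : {i // i ∉ S} → τ) (i : ι) :
    splitEquiv _ e (glue S a f) i = glue S (splitEquiv _ e a i) (splitEquiv _ e f i) := by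
  ext k
  by_cases hk : k ∈ S <;> simp [splitEquiv, glue, hk, Function.swap]

variable [Fintype ι] [DecidableEq ι] [Fintype τ] [∀ i, Fintype (σ i)]

lemma rdm_tensorState (e : τ ≃ ∀ i, σ i) (φ : ∀ i, (Fin n → σ i) → ℂ) (S : Finset (Fin n))
    (a b : {i // i ∈ S} → τ) :
    rdm S (tensorState e φ) a b =
      ∏ i, rdm S (φ i) (splitEquiv _ e a i) (splitEquiv _ e b i) := by
  simp only [rdm, Matrix.of_apply, tensorState, splitEquiv_glue, map_prod,
    ← Finset.prod_mul_distrib]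
  rw [Finset.prod_univ_sum, Fintype.piFinset_univ, ← (splitEquiv _ e).sum_comp]

lemma sum_normSq_tensorState (e : τ ≃ ∀ i, σ i) (φ : ∀ i, (Fin n → σ i) → ℂ) :
    ∑ g, Complex.normSq (tensorState e φ g) = ∏ i, ∑ g, Complex.normSq (φ i g) := by
  simp only [tensorState, map_prod]
  rw [Finset.prod_univ_sum, Fintype.piFinset_univ, ← (splitEquiv _ e).sum_comp]

lemma card_pow_inv (e : τ ≃ ∀ i, σ i) (r : ℕ) :
    ((Fintype.card τ : ℂ) ^ r)⁻¹ = ∏ i, ((Fintype.card (σ i) : ℂ) ^ r)⁻¹ := by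
  rw [Fintype.card_congr e, Fintype.card_pi]
  push_cast
  rw [← Finset.prod_pow, Finset.prod_inv_distrib]

variable [DecidableEq τ] [∀ i, DecidableEq (σ i)]

lemma IsAME.tensorState (e : τ ≃ ∀ i, σ i) {φ : ∀ i, (Fin n → σ i) → ℂ}
    (h : ∀ i, IsAME (φ i)) : IsAME (tensorState e φ) := by
  refine ⟨by simp [sum_normSq_tensorState, (h _).1], fun S hS => ?_⟩
  ext a b
  rw [rdm_tensorState, Matrix.smul_apply, card_pow_inv e, Matrix.one_apply, smul_eq_mul]
  simp only [(h _).2 S hS, Matrix.smul_apply, smul_eq_mul, Finset.prod_mul_distrib,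
    Matrix.one_apply, Fintype.prod_ite_zero, Finset.prod_const_one]
  congr 2
  rw [← funext_iff, (splitEquiv _ e).apply_eq_iff_eq]

/-- Every normalized tensor factor of an AME state is AME. -/
lemma IsAME.of_tensorState [∀ i, Nonempty (σ i)] (e : τ ≃ ∀ i, σ i)
    {φ : ∀ i, (Fin n → σ i) → ℂ} (hφ : ∀ i, ∑ g, Complex.normSq (φ i g) = 1)
    (h : ∀ S : Finset (Fin n), S.card = n / 2 → rdm S (_root_.tensorState e φ) =
      ((Fintype.card τ : ℂ) ^ S.card)⁻¹ • (1 : Matrix _ _ ℂ)) (j : ι) : IsAME (φ j) := by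
  refine ⟨hφ j, fun S hS => ?_⟩
  have key : ∀ a b : ∀ i, {k // k ∈ S} → σ i, ∏ i, rdm S (φ i) (a i) (b i) =
      ∏ i, (((Fintype.card (σ i) : ℂ) ^ S.card)⁻¹ • (1 : Matrix _ _ ℂ)) (a i) (b i) := by
    intro a b
    have := congrFun (congrFun (h S hS) ((splitEquiv _ e).symm a)) ((splitEquiv _ e).symm b)
    rw [rdm_tensorState, card_pow_inv e] at this
    simp only [Equiv.apply_symm_apply] at this
    rw [this]
    simp only [Matrix.smul_apply, smul_eq_mul, Finset.prod_mul_distrib,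
      Matrix.one_apply, Fintype.prod_ite_zero, Finset.prod_const_one]
    simp [funext_iff]
  ext x y
  -- Tracing out all tensor factors other than `j`.
  have tr : ∀ R : ∀ i, Matrix ({k // k ∈ S} → σ i) ({k // k ∈ S} → σ i) ℂ,
      (∀ i, ∑ a, R i a a = 1) →
      ∑ a : ∀ i, {k // k ∈ S} → σ i,
        (if a j = x then 1 else 0) * ∏ i, R i (a i) (Function.update a j y i) = R j x y := by
    intro R hR
    have : ∀ a : ∀ i, {k // k ∈ S} → σ i,
        (if a j = x then 1 else 0) * ∏ i, R i (a i) (Function.update a j y i) =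
        ∏ i, Function.update (fun i (c : {k // k ∈ S} → σ i) => R i c c) j
          (fun c => (if c = x then 1 else 0) * R j c y) i (a i) := by
      intro a
      rw [← Finset.mul_prod_erase _ _ (Finset.mem_univ j),
        ← Finset.mul_prod_erase _ _ (Finset.mem_univ j)]
      simp only [Function.update_self, ← mul_assoc]
      congr 1
      refine Finset.prod_congr rfl fun i hi => ?_
      simp [Function.update_of_ne (Finset.ne_of_mem_erase hi)]
    simp only [this]
    rw [← Fintype.piFinset_univ, ← Finset.prod_univ_sum,
      ← Finset.mul_prod_erase _ _ (Finset.mem_univ j), Finset.prod_eq_one]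
    · simp
    · intro i hi
      simp [Function.update_of_ne (Finset.ne_of_mem_erase hi), hR]
  rw [← tr (fun i => rdm S (φ i)) fun i => by simp [trace_rdm, hφ]]
  rw [← tr (fun i => ((Fintype.card (σ i) : ℂ) ^ S.card)⁻¹ • (1 : Matrix _ _ ℂ)) fun i => by simp]
  simp only [key]

end Tensor

section Pauli

lemma Xc_pow_apply (D x : ℕ) (a b : Fin D) :
    (Xc D ^ x) a b = if (b : ℕ) = (a + x) % D then 1 else 0 := by
  induction x generalizing b with
  | zero => simp [Matrix.one_apply, Nat.mod_eq_of_lt a.2, Fin.ext_iff, eq_comm]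
  | succ x ih =>
    have hD : 0 < D := a.pos
    rw [pow_succ, Matrix.mul_apply,
      Finset.sum_eq_single ⟨(a + x) % D, Nat.mod_lt _ hD⟩]
    · rw [ih]
      simp [Xc, add_assoc]
    · intro c _ hc
      rw [ih, if_neg (fun h => hc (Fin.ext h)), zero_mul]
    · simp

lemma Xc_pow_mul_Zc_pow_apply (D x z : ℕ) (a b : Fin D) :
    (Xc D ^ x * Zc D ^ z) a b =
      if (b : ℕ) = (a + x) % D then omegaD D ^ (z * (b : ℕ)) else 0 := by
  rw [Zc, Matrix.diagonal_pow, Matrix.mul_diagonal, Xc_pow_apply]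
  simp [← pow_mul, mul_comm]

lemma omegaD_pow_self {D : ℕ} (hD : D ≠ 0) : omegaD D ^ D = 1 := by
  rw [omegaD, ← Complex.exp_nat_mul, mul_div_cancel₀ _ (Nat.cast_ne_zero.2 hD),
    Complex.exp_two_pi_mul_I]

lemma omegaD_pow_mul_mod {D : ℕ} (hD : D ≠ 0) (z b : ℕ) :
    omegaD D ^ (z * (b % D)) = omegaD D ^ (z * b) := by
  conv_rhs => rw [← Nat.div_add_mod b D]
  rw [mul_add, pow_add, mul_left_comm, pow_mul _ D, omegaD_pow_self hD, one_pow, one_mul]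

lemma exp_div_pow_div {N q : ℕ} (hN : N ≠ 0) (h : q ∣ N) (c : ℂ) :
    Complex.exp (c / N) ^ (N / q) = Complex.exp (c / q) := by
  obtain ⟨r, rfl⟩ := h
  have hq : q ≠ 0 := left_ne_zero_of_mul hN
  have hr : r ≠ 0 := right_ne_zero_of_mul hN
  rw [← Complex.exp_nat_mul, Nat.mul_div_cancel_left _ (Nat.pos_of_ne_zero hq)]
  congr 1
  have : (q : ℂ) ≠ 0 := Nat.cast_ne_zero.2 hq
  have : (r : ℂ) ≠ 0 := Nat.cast_ne_zero.2 hr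
  push_cast
  field_simp

variable {ι : Type*} [Fintype ι] {q : ι → ℕ} {N n : ℕ}

/-- The Chinese remainder identification of `Fin (∏ i, q i)` with `∏ i, Fin (q i)`. -/
lemma exists_crtEquiv [DecidableEq ι] (hq : ∀ i, q i ≠ 0) (hco : Pairwise fun i j => (q i).Coprime (q j))
    (hN : N = ∏ i, q i) :
    ∃ e : Fin N ≃ ∀ i, Fin (q i), ∀ a i, (e a i : ℕ) = a % q i := by
  let f : Fin N → ∀ i, Fin (q i) :=
    fun a i => ⟨a % q i, Nat.mod_lt _ (Nat.pos_of_ne_zero (hq i))⟩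
  refine ⟨Equiv.ofBijective f ?_, fun a i => rfl⟩
  rw [Fintype.bijective_iff_injective_and_card]
  refine ⟨fun a b hab => ?_, by simp [hN]⟩
  have hab' : ∀ i, (a : ℕ) ≡ b [MOD q i] := fun i => Fin.ext_iff.1 (congrFun hab i)
  have : (a : ℕ) ≡ b [MOD N] := by
    rw [Nat.modEq_iff_dvd, congrArg (Nat.cast : ℕ → ℤ) hN, Nat.cast_prod]
    exact Fintype.prod_dvd_of_coprime
      (fun i j hij => Nat.isCoprime_iff_coprime.2 (hco hij))
      fun i => Nat.modEq_iff_dvd.1 (hab' i)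
  exact Fin.ext (Nat.ModEq.eq_of_lt_of_lt this a.2 b.2)

lemma exists_pauli_eq_prod (hq : ∀ i, q i ≠ 0) (hN : N = ∏ i, q i)
    {e : Fin N ≃ ∀ i, Fin (q i)} (he : ∀ a i, (e a i : ℕ) = a % q i)
    (x z : ι → ℕ) :
    ∃ x' z' : ℕ, ∀ a b : Fin N, (Xc N ^ x' * Zc N ^ z') a b =
      ∏ i, (Xc (q i) ^ x i * Zc (q i) ^ z i) (e a i) (e b i) := by
  have hN0 : N ≠ 0 := hN ▸ Finset.prod_ne_zero_iff.2 fun i _ => hq i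
  have hdvd : ∀ i, q i ∣ N := fun i => hN ▸ Finset.dvd_prod_of_mem q (Finset.mem_univ i)
  let x' : Fin N := e.symm fun i => ⟨x i % q i, Nat.mod_lt _ (Nat.pos_of_ne_zero (hq i))⟩
  have hx : ∀ i, (x' : ℕ) ≡ x i [MOD q i] := fun i => by
    rw [Nat.ModEq, ← he x' i]
    simp [x']
  refine ⟨x', ∑ i, N / q i * z i, fun a b => ?_⟩
  simp only [Xc_pow_mul_Zc_pow_apply, Fintype.prod_ite_zero]
  congr 1
  · have : b = ⟨(a + x') % N, Nat.mod_lt _ (Nat.pos_of_ne_zero hN0)⟩ ↔ ∀ i, (e b i : ℕ) =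
        (e a i + x i) % q i := by
      rw [← e.apply_eq_iff_eq, funext_iff]
      refine forall_congr' fun i => ?_
      rw [Fin.ext_iff, he _ i, he _ i, he _ i, Nat.mod_mod_of_dvd _ (hdvd i), Nat.mod_add_mod]
      rw [((hx i).add_left (a : ℕ) : (_ % _ = _ % _))]
    rw [← this, Fin.ext_iff]
  · rw [Finset.sum_mul, Finset.prod_pow_eq_pow_sum _ _ _ |>.symm]
    refine Finset.prod_congr rfl fun i _ => ?_
    rw [he b i, omegaD_pow_mul_mod (hq i), mul_assoc, pow_mul, omegaD,
      exp_div_pow_div hN0 (hdvd i), omegaD]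

lemma IsPauliProd.submatrix_piKronecker (hq : ∀ i, q i ≠ 0) (hN : N = ∏ i, q i)
    {e : Fin N ≃ ∀ i, Fin (q i)} (he : ∀ a i, (e a i : ℕ) = a % q i)
    {s : ∀ i, Matrix (Fin n → Fin (q i)) (Fin n → Fin (q i)) ℂ} (hs : ∀ i, IsPauliProd (s i)) :
    IsPauliProd ((piKronecker s).submatrix (splitEquiv (Fin n) e) (splitEquiv (Fin n) e)) := by
  have hN0 : N ≠ 0 := hN ▸ Finset.prod_ne_zero_iff.2 fun i _ => hq i
  have hdvd : ∀ i, q i ∣ N := fun i => hN ▸ Finset.dvd_prod_of_mem q (Finset.mem_univ i)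
  choose γ x z hs using hs
  choose x' z' h using fun k => exists_pauli_eq_prod hq hN he (fun i => x i k) fun i => z i k
  refine ⟨∑ i, N / q i * γ i, x', z', ?_⟩
  ext a b
  simp only [Matrix.submatrix_apply, piKronecker, Matrix.of_apply, hs, pauliProd,
    Matrix.smul_apply, smul_eq_mul, Finset.prod_mul_distrib, h]
  rw [Finset.prod_comm, ← Finset.prod_pow_eq_pow_sum]
  congr 1
  refine Finset.prod_congr rfl fun i _ => ?_
  rw [pow_mul, exp_div_pow_div hN0 (hdvd i)]

lemma IsStabState.tensorState [DecidableEq ι] (hq : ∀ i, q i ≠ 0) (hN : N = ∏ i, q i)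
    {e : Fin N ≃ ∀ i, Fin (q i)} (he : ∀ a i, (e a i : ℕ) = a % q i)
    {φ : ∀ i, (Fin n → Fin (q i)) → ℂ} (h : ∀ i, IsStabState (φ i)) :
    IsStabState (tensorState e φ) := by
  refine ⟨by simp [sum_normSq_tensorState, (h _).1], ?_⟩
  choose S hP h1 hmul hli hcard hfix using fun i => (h i).2
  let E := splitEquiv (Fin n) e
  let F : (∀ i, S i) → Matrix (Fin n → Fin N) (Fin n → Fin N) ℂ :=
    fun s => (piKronecker fun i => (s i).1).submatrix E E
  have hF : LinearIndependent ℂ F :=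
    (linearIndependent_piKronecker hli).map'
      (Matrix.reindexLinearEquiv ℂ ℂ E.symm E.symm).toLinearMap (LinearEquiv.ker _)
  have hFmul : ∀ s t, F s * F t =
      (piKronecker fun i => (s i).1 * (t i).1).submatrix E E := fun s t => by
    rw [Matrix.submatrix_mul_equiv, piKronecker_mul]
  refine ⟨Finset.univ.image F, ?_, ?_, ?_, ?_, ?_, ?_⟩
  · simp only [Finset.mem_image, Finset.mem_univ, true_and, forall_exists_index,
      forall_apply_eq_imp_iff]
    exact fun s => IsPauliProd.submatrix_piKronecker hq hN he fun i => hP i _ (s i).2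
  · refine Finset.mem_image.2 ⟨fun i => ⟨1, h1 i⟩, Finset.mem_univ _, ?_⟩
    simp [F, piKronecker_one]
  · simp only [Finset.mem_image, Finset.mem_univ, true_and, forall_exists_index,
      forall_apply_eq_imp_iff]
    refine fun s t => ⟨⟨fun i => ⟨_, (hmul i _ (s i).2 _ (t i).2).1⟩, (hFmul s t).symm⟩, ?_⟩
    rw [hFmul, hFmul]
    simp only [fun i => (hmul i _ (s i).2 _ (t i).2).2]
  · refine hF.linearIndepOn_id.comp
      (fun s : Finset.univ.image F => (⟨s.1, (Finset.mem_image.1 s.2).imp fun _ h => h.2⟩ : Set.range F)) ?_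
    exact fun s t hst => Subtype.ext (congrArg (fun u : Set.range F => u.1) hst)
  · rw [Finset.card_image_of_injective _ hF.injective, Finset.card_univ, Fintype.card_pi]
    simp [hcard, hN, Finset.prod_pow]
  · simp only [Finset.mem_image, Finset.mem_univ, true_and, forall_exists_index,
      forall_apply_eq_imp_iff]
    intro s
    ext g
    have := piKronecker_mulVec_prod (fun i => (s i).1) φ (E g)
    simp only [fun i => hfix i _ (s i).2] at this
    rw [_root_.tensorState, ← this]
    exact (E.sum_comp fun b => piKronecker (fun i => (s i).1) (E g) b * ∏ i, φ i (b i))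

end Pauli

/-- assuming the factorization theorem for stabilizer states (Looi–Griffiths),
the existence of a stabilizer `AME(n, D)` state with `D = ∏_i p_i^{e_i}` implies, for every
nonempty subset `M` of the prime-power factors, the existence of a stabilizer
`AME(n, ∏_{i∈M} q_i)` state. -/
theorem stabilizer_AME_prime_power_reduction (n m D : ℕ) (hn : 2 ≤ n) (hm : 1 ≤ m)
    (p e : Fin m → ℕ) (hp : ∀ i, (p i).Prime) (hinj : Function.Injective p)
    (he : ∀ i, 1 ≤ e i) (q : Fin m → ℕ) (hq : ∀ i, q i = p i ^ e i)
    (hD : D = ∏ i, q i)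
    (hFact : ∀ Φ : (Fin n → Fin D) → ℂ, IsStabState Φ →
      ∃ U : Matrix (∀ i, Fin (q i)) (Fin D) ℂ,
        Uᴴ * U = 1 ∧ U * Uᴴ = 1 ∧
        ∃ φ : ∀ i, (Fin n → Fin (q i)) → ℂ,
          (∀ i, IsStabState (φ i)) ∧ (tpow n U).mulVec Φ = regroup q φ)
    (hEx : ∃ Ψ : (Fin n → Fin D) → ℂ, IsStabState Ψ ∧ IsAME Ψ) :
    ∀ M : Finset (Fin m), M.Nonempty →
      ∃ ψ : (Fin n → Fin (∏ i ∈ M, q i)) → ℂ, IsStabState ψ ∧ IsAME ψ := by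
  obtain ⟨Ψ, hΨ, hAME⟩ := hEx
  obtain ⟨U, hU, hU', φ, hφ, hUΨ⟩ := hFact Ψ hΨ
  have hq0 : ∀ i, q i ≠ 0 := fun i => hq i ▸ pow_ne_zero _ (hp i).ne_zero
  have : ∀ i, Nonempty (Fin (q i)) := fun i => ⟨⟨0, Nat.pos_of_ne_zero (hq0 i)⟩⟩
  have hreg : regroup q φ = tensorState (Equiv.refl _) φ := rfl
  have hφAME : ∀ i, IsAME (φ i) := by
    refine IsAME.of_tensorState (Equiv.refl _) (fun i => (hφ i).1) fun S hS => ?_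
    rw [← hreg, ← hUΨ]
    have hcard : Fintype.card (∀ i, Fin (q i)) = Fintype.card (Fin D) := by simp [hD]
    rw [hcard]
    exact rdm_tpow_mulVec_of_unitary S hU hU' Ψ _ (hAME.2 S hS)
  intro M _
  have hN : ∏ i ∈ M, q i = ∏ i : M, q i := (Finset.prod_coe_sort M q).symm
  have hco : Pairwise fun i j : M => (q i).Coprime (q j) := fun i j hij => by
    simp only [hq]
    exact Nat.Coprime.pow _ _ ((Nat.coprime_primes (hp _) (hp _)).2
      fun h => hij (Subtype.ext (hinj h)))
  obtain ⟨e', he'⟩ := exists_crtEquiv (fun i : M => hq0 i) hco hN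
  exact ⟨tensorState e' fun i : M => φ i,
    IsStabState.tensorState (fun i : M => hq0 i) hN he' fun i => hφ i,
    IsAME.tensorState e' fun i => hφAME i⟩
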